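/- Let V be a finite-dimensional real inner product space and A : V → V a linear map all of whose complex eigenvalues have positive real part. Then there exists an inner product ⟨·,·⟩' on V such that ⟨v, A v⟩' > 0 for all nonzero v ∈ V. -/

import Mathlib

theorem lyapunov_aux (n : ℕ) : ∀ (W : Type*) [AddCommGroup W] [Module ℂ W] [Module ℝ W]
    [IsScalarTower ℝ ℂ W] [FiniteDimensional ℂ W] (T : W →ₗ[ℂ] W),
    Module.finrank ℂ W = n →
    (∀ μ : ℂ, Module.End.HasEigenvalue T μ → 0 < μ.re) →
    ∃ (B : W →ₗ[ℝ] W →ₗ[ℝ] ℝ) (α : ℝ), 0 < α ∧ (∀ x y, B x y = B y x) ∧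
      (∀ x, x ≠ 0 → 0 < B x x) ∧ (∀ v, α * B v v ≤ B v (T v)) := by
  induction n with
  | zero =>
    intro W _ _ _ _ _ T hn _
    have : Subsingleton W := Module.finrank_zero_iff.mp hn
    exact ⟨0, 1, one_pos, by simp, fun x hx => absurd (Subsingleton.elim x 0) hx, by simp⟩
  | succ n ih =>
    intro W _ _ _ _ _ T hn heig
    have hnt : Nontrivial W := Module.nontrivial_of_finrank_pos (R := ℂ) (by omega)
    obtain ⟨μ, hμ⟩ := Module.End.exists_eigenvalue T
    have hμpos := heig μ hμ
    have hlt : LinearMap.range (T - μ • LinearMap.id) < ⊤ := by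
      rw [lt_top_iff_ne_top]
      intro h
      have hinj := LinearMap.ker_eq_bot_iff_range_eq_top.mpr h
      obtain ⟨e, he⟩ := hμ.exists_hasEigenvector
      apply he.2
      have : e ∈ LinearMap.ker (T - μ • LinearMap.id) := by
        simp [LinearMap.mem_ker, he.apply_eq_smul]
      rw [hinj] at this
      simpa using this
    obtain ⟨f, hf0, hfle⟩ := Submodule.exists_le_ker_of_lt_top _ hlt
    have hfT : ∀ v, f (T v) = μ * f v := by
      intro v
      have h1 : (T - μ • LinearMap.id : W →ₗ[ℂ] W) v ∈ LinearMap.ker f := hfle ⟨v, rfl⟩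
      simp [LinearMap.mem_ker, sub_eq_zero] at h1
      exact h1
    obtain ⟨w, hw⟩ : ∃ w, f w = 1 := by
      obtain ⟨x, hx⟩ : ∃ x, f x ≠ 0 := by
        by_contra! h
        exact hf0 (LinearMap.ext h)
      exact ⟨(f x)⁻¹ • x, by simp [hx]⟩
    have hinv : ∀ x ∈ LinearMap.ker f, T x ∈ LinearMap.ker f := by
      intro x hx
      rw [LinearMap.mem_ker] at hx ⊢
      rw [hfT, hx, mul_zero]
    have hfin : Module.finrank ℂ (LinearMap.ker f) = n := by
      have h1 := LinearMap.finrank_range_add_finrank_ker f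
      have h2 : LinearMap.range f = ⊤ := by
        rw [LinearMap.range_eq_top]
        intro c
        exact ⟨c • w, by simp [hw]⟩
      rw [h2, finrank_top, Module.finrank_self] at h1
      omega
    obtain ⟨BU, α, hα, hsymm, hpos, hcoer⟩ := ih (LinearMap.ker f) (T.restrict hinv) hfin (by
      intro ν hν
      apply heig
      obtain ⟨e, he⟩ := hν.exists_hasEigenvector
      apply Module.End.hasEigenvalue_of_hasEigenvector (x := (e : W))
      rw [Module.End.hasEigenvector_iff, Module.End.mem_eigenspace_iff]
      refine ⟨?_, fun h => he.2 (Subtype.ext h)⟩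
      exact congrArg Subtype.val he.apply_eq_smul)
    let p : W →ₗ[ℂ] LinearMap.ker f :=
      LinearMap.codRestrict _ (LinearMap.id - f.smulRight w) (by
        intro v; simp [LinearMap.mem_ker, hw])
    have hp : ∀ v, ((p v : LinearMap.ker f) : W) = v - f v • w := fun v => rfl
    set u0 := p (T w) with hu0
    have hpT : ∀ v, p (T v) = T.restrict hinv (p v) + f v • u0 := by
      intro v
      apply Subtype.ext
      simp only [Submodule.coe_add, Submodule.coe_smul, hu0, hp, LinearMap.coe_restrict_apply,
        map_sub, map_smul, hfT, hw]
      module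
    have hnn : ∀ x, 0 ≤ BU x x := by
      intro x
      by_cases h : x = 0
      · simp [h]
      · exact (hpos x h).le
    obtain ⟨M, hM0, hM⟩ : ∃ M : ℝ, 0 ≤ M ∧ ∀ c : ℂ,
        BU (c • u0) (c • u0) ≤ M * (c.re * c.re + c.im * c.im) := by
      refine ⟨2 * (BU u0 u0 + BU (Complex.I • u0) (Complex.I • u0)),
        by have := hnn u0; have := hnn (Complex.I • u0); positivity, ?_⟩
      intro c
      have hc : c • u0 = c.re • u0 + c.im • (Complex.I • u0) := by
        conv_lhs => rw [← Complex.re_add_im c]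
        rw [add_smul, mul_smul, ← algebraMap_smul ℂ c.re u0,
          ← algebraMap_smul ℂ c.im (Complex.I • u0)]
        rfl
      have h1 := hnn u0
      have h2 := hnn (Complex.I • u0)
      have h3 := hnn (c.re • u0 - c.im • (Complex.I • u0))
      rw [hc]
      simp only [map_add, map_sub, map_smul, LinearMap.add_apply, LinearMap.sub_apply,
        LinearMap.smul_apply, smul_eq_mul] at h3 ⊢
      nlinarith [mul_nonneg (mul_self_nonneg c.re) h2, mul_nonneg (mul_self_nonneg c.im) h1]
    have hcs : ∀ (u : LinearMap.ker f) (y : LinearMap.ker f),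
        -(α / 2 * BU u u) - BU y y / (2 * α) ≤ BU u y := by
      intro u y
      have h := hnn (α • u + y)
      simp only [map_add, map_smul, LinearMap.add_apply, LinearMap.smul_apply, smul_eq_mul,
        hsymm y u] at h
      have h2 : -(α / 2 * BU u u) - BU y y / (2 * α) =
        (-(α * (α * BU u u)) - BU y y) / (2 * α) := by field_simp
      rw [h2, div_le_iff₀ (by positivity)]
      linarith
    set K : ℝ := M / (α * μ.re) + 1 with hK
    have hK0 : 0 < K := by positivity
    have hKM : M / (2 * α) ≤ K * μ.re / 2 := by
      have : K * μ.re / 2 = M / (2 * α) + μ.re / 2 := by rw [hK]; field_simp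
      linarith
    let fr : W →ₗ[ℝ] ℝ := Complex.reLm ∘ₗ f.restrictScalars ℝ
    let fi : W →ₗ[ℝ] ℝ := Complex.imLm ∘ₗ f.restrictScalars ℝ
    let B : W →ₗ[ℝ] W →ₗ[ℝ] ℝ :=
      BU.compl₁₂ (p.restrictScalars ℝ) (p.restrictScalars ℝ) +
      K • ((LinearMap.mul ℝ ℝ).compl₁₂ fr fr + (LinearMap.mul ℝ ℝ).compl₁₂ fi fi)
    have hB : ∀ x y, B x y = BU (p x) (p y) +
        K * ((f x).re * (f y).re + (f x).im * (f y).im) := fun x y => rfl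
    refine ⟨B, min (α / 2) (μ.re / 2), by positivity, ?_, ?_, ?_⟩
    · intro x y
      rw [hB, hB, hsymm]; ring
    · intro x hx
      rw [hB]
      by_cases h : p x = 0
      · have hfx : f x ≠ 0 := by
          intro h0
          have := hp x
          rw [h, h0] at this
          simp at this
          exact hx this.symm
        have := Complex.normSq_pos.mpr hfx
        rw [Complex.normSq_apply] at this
        have h3 := hnn (p x)
        have := mul_pos hK0 this
        linarith
      · have := hpos _ h
        have h3 : 0 ≤ K * ((f x).re * (f x).re + (f x).im * (f x).im) :=
          mul_nonneg hK0.le (add_nonneg (mul_self_nonneg _) (mul_self_nonneg _))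
        linarith
    · intro v
      rw [hB, hB, hpT, hfT, map_add]
      have h1 := hcoer (p v)
      have h2 := hcs (p v) (f v • u0)
      have h3 := hM (f v)
      set s := (f v).re * (f v).re + (f v).im * (f v).im with hs
      have hs0 : 0 ≤ s := add_nonneg (mul_self_nonneg _) (mul_self_nonneg _)
      have h4 : (f v).re * (μ * f v).re + (f v).im * (μ * f v).im = μ.re * s := by
        rw [hs, Complex.mul_re, Complex.mul_im]; ring
      rw [h4]
      have h5 : BU (f v • u0) (f v • u0) / (2 * α) ≤ K * μ.re / 2 * s := by
        calc _ ≤ M * s / (2 * α) := by gcongr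
          _ = M / (2 * α) * s := by ring
          _ ≤ _ := by gcongr
      have h6 : min (α / 2) (μ.re / 2) * BU (p v) (p v) ≤ α / 2 * BU (p v) (p v) :=
        mul_le_mul_of_nonneg_right (min_le_left _ _) (hnn _)
      have h7 : min (α / 2) (μ.re / 2) * (K * s) ≤ μ.re / 2 * (K * s) :=
        mul_le_mul_of_nonneg_right (min_le_right _ _) (mul_nonneg hK0.le hs0)
      linarith



/-- If every complex eigenvalue of A has positive real part, there is an inner
product (a symmetric positive definite bilinear form B) on V with
⟨v, A v⟩' > 0 for all nonzero v. -/
theorem exists_lyapunov_inner_product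
    (V : Type*) [NormedAddCommGroup V] [InnerProductSpace ℝ V] [FiniteDimensional ℝ V]
    (A : V →ₗ[ℝ] V)
    (heig : ∀ μ : ℂ, Module.End.HasEigenvalue (A.baseChange ℂ) μ → 0 < μ.re) :
    ∃ B : V →ₗ[ℝ] V →ₗ[ℝ] ℝ,
      (∀ x y : V, B x y = B y x) ∧
      (∀ x : V, x ≠ 0 → 0 < B x x) ∧
      (∀ v : V, v ≠ 0 → 0 < B v (A v)) := by

  obtain ⟨B, α, hα, hs, hp, hc⟩ := lyapunov_aux _ (TensorProduct ℝ ℂ V) (A.baseChange ℂ) rfl heig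
  let i : V →ₗ[ℝ] TensorProduct ℝ ℂ V := TensorProduct.mk ℝ ℂ V 1
  have hi : ∀ x : V, x ≠ 0 → i x ≠ 0 := by
    intro x hx h
    apply hx
    have hinj : Function.Injective i :=
      Module.FaithfullyFlat.tensorProduct_mk_injective (A := ℝ) (B := ℂ) V
    exact hinj (by rw [h, map_zero])
  refine ⟨B.compl₁₂ i i, fun x y => hs _ _, fun x hx => hp _ (hi x hx), fun v hv => ?_⟩
  have h1 := hc (i v)
  have h2 := mul_pos hα (hp _ (hi v hv))
  have h3 : A.baseChange ℂ (i v) = i (A v) := rfl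
  rw [h3] at h1
  exact lt_of_lt_of_le h2 h1
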